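/- For all agents a, b ∈ A and every formula φ of L_∀, the formula ∃_a ∃_b φ ↔ ∃_b ∃_a φ is valid. -/

import Mathlib

/-- A Kripke model over agents `A` and propositional variables `P`. -/
structure KModel (A P : Type) where
  S : Type
  R : A → S → S → Prop
  V : P → S → Prop

/-- `Refines B M s N t`: there is a `B`-refinement from `M_s` to `N_t`. -/
def Refines {A P : Type} (B : Set A) (M : KModel A P) (s : M.S)
    (N : KModel A P) (t : N.S) : Prop :=
  ∃ Z : M.S → N.S → Prop,
    Z s t ∧
    (∀ u v, Z u v → ∀ p, M.V p u ↔ N.V p v) ∧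
    (∀ a : A, ∀ u v, Z u v → ∀ v', N.R a v v' → ∃ u', M.R a u u' ∧ Z u' v') ∧
    (∀ a : A, a ∉ B → ∀ u v, Z u v → ∀ u', M.R a u u' → ∃ v', N.R a v v' ∧ Z u' v')

/-- The language `L_∀` of refinement modal logic. -/
inductive RForm (A P : Type) : Type where
  | atom : P → RForm A P
  | neg : RForm A P → RForm A P
  | and : RForm A P → RForm A P → RForm A P
  | box : A → RForm A P → RForm A P
  | rall : A → RForm A P → RForm A P

/-- Satisfaction for refinement modal logic. -/
def Sat {A P : Type} : (M : KModel A P) → M.S → RForm A P → Prop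
  | M, s, .atom p => M.V p s
  | M, s, .neg φ => ¬ Sat M s φ
  | M, s, .and φ ψ => Sat M s φ ∧ Sat M s ψ
  | M, s, .box a φ => ∀ t, M.R a s t → Sat M t φ
  | M, s, .rall a φ => ∀ (N : KModel A P) (t : N.S), Refines {a} M s N t → Sat N t φ

/-- Material implication `φ → ψ`, as an abbreviation. -/
def fimp {A P : Type} (φ ψ : RForm A P) : RForm A P := .neg (.and φ (.neg ψ))

/-- Biimplication `φ ↔ ψ`, as an abbreviation. -/
def fiff {A P : Type} (φ ψ : RForm A P) : RForm A P := .and (fimp φ ψ) (fimp ψ φ)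

/-- `◇_a φ := ¬□_a ¬φ`. -/
def fdia {A P : Type} (a : A) (φ : RForm A P) : RForm A P := .neg (.box a (.neg φ))

/-- `∃_a φ := ¬∀_a ¬φ`. -/
def fex {A P : Type} (a : A) (φ : RForm A P) : RForm A P := .neg (.rall a (.neg φ))

/-- A formula is valid iff it is true at every pointed model. -/
def Valid {A P : Type} (φ : RForm A P) : Prop :=
  ∀ (M : KModel A P) (s : M.S), Sat M s φ

/-- Refinements compose, uniting the sets of agents for which forth may fail. -/
theorem Refines.trans {A P : Type} {B C : Set A} {M N K : KModel A P} {s : M.S} {n : N.S}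
    {t : K.S} (h₁ : Refines B M s N n) (h₂ : Refines C N n K t) : Refines (B ∪ C) M s K t := by
  obtain ⟨Y, hY, atomsY, backY, forthY⟩ := h₁
  obtain ⟨Z, hZ, atomsZ, backZ, forthZ⟩ := h₂
  refine ⟨fun u w => ∃ v, Y u v ∧ Z v w, ⟨n, hY, hZ⟩, ?_, ?_, ?_⟩
  · rintro u w ⟨v, huv, hvw⟩ p
    exact (atomsY u v huv p).trans (atomsZ v w hvw p)
  · rintro c u w ⟨v, huv, hvw⟩ w' hw
    obtain ⟨v', hv, hvw'⟩ := backZ c v w hvw w' hw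
    obtain ⟨u', hu, huv'⟩ := backY c u v huv v' hv
    exact ⟨u', hu, v', huv', hvw'⟩
  · rintro c hc u w ⟨v, huv, hvw⟩ u' hu
    obtain ⟨v', hv, huv'⟩ := forthY c (fun h => hc (Or.inl h)) u v huv u' hu
    obtain ⟨w', hw, hvw'⟩ := forthZ c (fun h => hc (Or.inr h)) v w hvw v' hv
    exact ⟨w', hw, v', huv', hvw'⟩

/-- The product of `M` and `K` along `Z`, together with a copy of `M` that is reached from
the product by all arrows of `M` for agents in `C`. -/
def KModel.interpolant {A P : Type} (C : Set A) (M K : KModel A P) (Z : M.S → K.S → Prop) :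
    KModel A P where
  S := M.S ⊕ (M.S × K.S)
  R c x y := match x, y with
    | .inl u, .inl u' => M.R c u u'
    | .inl _, .inr _ => False
    | .inr x, .inl u' => c ∈ C ∧ M.R c x.1 u'
    | .inr x, .inr y => M.R c x.1 y.1 ∧ K.R c x.2 y.2 ∧ Z y.1 y.2
  V p x := match x with
    | .inl u => M.V p u
    | .inr x => M.V p x.1

/-- A refinement for a union of two sets of agents splits into two successive refinements. -/
theorem Refines.exists_of_union {A P : Type} {B C : Set A} {M K : KModel A P} {s : M.S}
    {t : K.S} (h : Refines (B ∪ C) M s K t) :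
    ∃ (N : KModel A P) (n : N.S), Refines B M s N n ∧ Refines C N n K t := by
  obtain ⟨Z, hZ, atoms, back, forth⟩ := h
  refine ⟨M.interpolant C K Z, .inr (s, t), ⟨fun u x => match x with
    | .inl v => u = v
    | .inr y => u = y.1 ∧ Z y.1 y.2, ⟨rfl, hZ⟩, ?_, ?_, ?_⟩, ⟨fun x w => match x with
    | .inl _ => False
    | .inr y => y.2 = w ∧ Z y.1 y.2, ⟨rfl, hZ⟩, ?_, ?_, ?_⟩⟩
  · rintro u (v | ⟨v, w⟩) h p
    · cases h
      exact Iff.rfl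
    · cases h.1
      exact Iff.rfl
  · rintro c u (v | ⟨v, w⟩) h (v' | ⟨v', w'⟩) hr
    · cases h
      exact ⟨v', hr, rfl⟩
    · exact hr.elim
    · cases h.1
      exact ⟨v', hr.2, rfl⟩
    · cases h.1
      exact ⟨v', hr.1, rfl, hr.2.2⟩
  · rintro c hc u (v | ⟨v, w⟩) h u' hu
    · cases h
      exact ⟨.inl u', hu, rfl⟩
    · obtain ⟨rfl, hz⟩ := h
      by_cases hC : c ∈ C
      · exact ⟨.inl u', ⟨hC, hu⟩, rfl⟩
      · obtain ⟨w', hw, hz'⟩ := forth c (fun h => h.elim hc hC) _ _ hz u' hu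
        exact ⟨.inr (u', w'), ⟨hu, hw, hz'⟩, rfl, hz'⟩
  · rintro (v | ⟨v, w⟩) w' h p
    · exact h.elim
    · obtain ⟨rfl, hz⟩ := h
      exact atoms _ _ hz p
  · rintro c (v | ⟨v, w⟩) x h w' hw
    · exact h.elim
    · obtain ⟨rfl, hz⟩ := h
      obtain ⟨v', hv, hz'⟩ := back c _ _ hz w' hw
      exact ⟨.inr (v', w'), ⟨hv, hw, hz'⟩, rfl, hz'⟩
  · rintro c hc (v | ⟨v, w⟩) x h (v' | ⟨v', w'⟩) hr
    · exact h.elim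
    · exact h.elim
    · exact (hc hr.1).elim
    · cases h.1
      exact ⟨w', hr.2.1, rfl, hr.2.2⟩

theorem sat_fex {A P : Type} {M : KModel A P} {s : M.S} {a : A} {φ : RForm A P} :
    Sat M s (fex a φ) ↔ ∃ (N : KModel A P) (t : N.S), Refines {a} M s N t ∧ Sat N t φ := by
  simp [fex, Sat]

theorem Sat.fex_fex_comm {A P : Type} {M : KModel A P} {s : M.S} {a b : A} {φ : RForm A P}
    (h : Sat M s (fex a (fex b φ))) : Sat M s (fex b (fex a φ)) := by
  obtain ⟨N, n, hMN, h⟩ := sat_fex.1 h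
  obtain ⟨K, t, hNK, h⟩ := sat_fex.1 h
  have hMK := hMN.trans hNK
  rw [Set.union_comm] at hMK
  obtain ⟨N', n', hMN', hNK'⟩ := hMK.exists_of_union
  exact sat_fex.2 ⟨N', n', hMN', sat_fex.2 ⟨K, t, hNK', h⟩⟩

/-- `∃_a ∃_b φ ↔ ∃_b ∃_a φ` is valid. -/
theorem ex_ex_comm_valid {A P : Type} (a b : A) (φ : RForm A P) :
    Valid (fiff (fex a (fex b φ)) (fex b (fex a φ))) := by
  intro M s
  exact ⟨fun h => h.2 h.1.fex_fex_comm, fun h => h.2 h.1.fex_fex_comm⟩
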